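/- arXiv:1404.7606 — 5 statements merged into one kernel-verified Lean document; each statement's English description precedes it below -/
import Mathlib

section
/- Let ω ∈ ℂ with Im ω > 0, let Λ = {n + m·ω : n, m ∈ ℤ} ⊂ ℂ, and let a, b ∈ ℂ satisfy a·Λ ⊆ Λ and |a|² ≥ 2. Let A : ℂ/Λ → ℂ/Λ be the map induced by z ↦ a·z + b. Then A admits an eventually simply-connected wandering continuum if and only if a is an integer. -/
open Complex

/-- The lattice Λ = {n + m·ω : n, m ∈ ℤ} as an additive subgroup of ℂ. -/
noncomputable def Lambda (ω : ℂ) : AddSubgroup ℂ where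
  carrier := {z : ℂ | ∃ n m : ℤ, z = (n : ℂ) + (m : ℂ) * ω}
  add_mem' := by
    rintro x y ⟨n1, m1, rfl⟩ ⟨n2, m2, rfl⟩
    exact ⟨n1 + n2, m1 + m2, by push_cast; ring⟩
  zero_mem' := ⟨0, 0, by simp⟩
  neg_mem' := by
    rintro x ⟨n, m, rfl⟩
    exact ⟨-n, -m, by push_cast; ring⟩

/-- The quotient map π : ℂ → ℂ/Λ. -/
noncomputable def pr (ω : ℂ) : ℂ → ℂ ⧸ Lambda ω := QuotientAddGroup.mk' (Lambda ω)

/-- A line in ℂ. -/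
def IsLine (L : Set ℂ) : Prop :=
  ∃ z₀ v : ℂ, v ≠ 0 ∧ L = {z | ∃ t : ℝ, z = z₀ + t * v}

/-- A nondegenerate line segment in ℂ. -/
def IsSegment (B : Set ℂ) : Prop :=
  ∃ z₀ v : ℂ, v ≠ 0 ∧ B = {z | ∃ t : ℝ, t ∈ Set.Icc (0 : ℝ) 1 ∧ z = z₀ + t * v}

/-- A continuum: a compact connected set with more than one point. -/
def IsContinuum {X : Type*} [TopologicalSpace X] (E : Set X) : Prop :=
  IsCompact E ∧ IsConnected E ∧ E.Nontrivial

/-- E is wandering for A. -/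
def Wandering {X : Type*} (A : X → X) (E : Set X) : Prop :=
  ∀ n m : ℕ, m < n → A^[n] '' E ∩ A^[m] '' E = ∅

/-- A continuum in the torus is simply-connected. -/
def IsSCContinuum (ω : ℂ) (E : Set (ℂ ⧸ Lambda ω)) : Prop :=
  ∃ U : Set (ℂ ⧸ Lambda ω), IsOpen U ∧ SimplyConnectedSpace U ∧ E ⊆ U ∧ IsConnected (U \ E)

/-- A real function on the unit interval along which `cos` stays positive and whose `sin` goes
from positive to negative decreases from one end to the other. -/
lemma lt_of_cos_pos_of_sin {f : unitInterval → ℝ} (hf : Continuous f)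
    (hcos : ∀ t, 0 < Real.cos (f t)) (h0 : 0 < Real.sin (f 0)) (h1 : Real.sin (f 1) < 0) :
    f 1 < f 0 := by
  by_contra! hle
  have hsub : ∀ x ∈ Set.Icc (f 0) (f 1), 0 < Real.cos x := by
    intro x hx
    obtain ⟨t, rfl⟩ := mem_range_of_exists_le_of_exists_ge hf ⟨0, hx.1⟩ ⟨1, hx.2⟩
    exact hcos t
  have hmono : MonotoneOn Real.sin (Set.Icc (f 0) (f 1)) := by
    refine monotoneOn_of_deriv_nonneg (convex_Icc _ _) Real.continuous_sin.continuousOn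
      Real.differentiable_sin.differentiableOn fun x hx => ?_
    rw [Real.deriv_sin]
    exact (hsub x (interior_subset hx)).le
  have := hmono (Set.left_mem_Icc.2 hle) (Set.right_mem_Icc.2 hle) hle
  linarith

/-- Poincaré–Miranda theorem on the unit square. -/
theorem exists_zero_of_sign_change (h : C(unitInterval × unitInterval, ℂ))
    (hl : ∀ t, (h (0, t)).re < 0) (hr : ∀ t, 0 < (h (1, t)).re)
    (hb : ∀ s, 0 < (h (s, 0)).im) (ht : ∀ s, (h (s, 1)).im < 0) : ∃ x, h x = 0 := by
  by_contra! hne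
  have : LocallyPathConnectedSpace unitInterval :=
    (convex_Icc (0 : ℝ) 1).locallyPathConnectedSpace
  have : ContractibleSpace unitInterval :=
    (convex_Icc (0 : ℝ) 1).contractibleSpace (Set.nonempty_Icc.2 zero_le_one)
  obtain ⟨G, ⟨-, hG⟩, -⟩ := isCoveringMapOn_exp.existsUnique_continuousMap_lifts h
    (a₀ := (0, 0)) (e₀ := log (h (0, 0))) (exp_log (hne _)) (fun x => hne x)
  have hre : ∀ x, (h x).re = Real.exp (G x).re * Real.cos (G x).im := fun x => by
    rw [← exp_re, ← hG]; rfl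
  have him : ∀ x, (h x).im = Real.exp (G x).re * Real.sin (G x).im := fun x => by
    rw [← exp_im, ← hG]; rfl
  have hcp : ∀ x, 0 < (h x).re → 0 < Real.cos (G x).im := fun x hx =>
    pos_of_mul_pos_right (hre x ▸ hx) (Real.exp_pos _).le
  have hcn : ∀ x, (h x).re < 0 → Real.cos (G x).im < 0 := fun x hx =>
    neg_of_mul_neg_right (hre x ▸ hx) (Real.exp_pos _).le
  have hsp : ∀ x, 0 < (h x).im → 0 < Real.sin (G x).im := fun x hx =>
    pos_of_mul_pos_right (him x ▸ hx) (Real.exp_pos _).le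
  have hsn : ∀ x, (h x).im < 0 → Real.sin (G x).im < 0 := fun x hx =>
    neg_of_mul_neg_right (him x ▸ hx) (Real.exp_pos _).le
  have right := lt_of_cos_pos_of_sin (f := fun t => (G (1, t)).im) (by fun_prop)
    (fun t => hcp _ (hr t)) (hsp _ (hb 1)) (hsn _ (ht 1))
  have top := lt_of_cos_pos_of_sin (f := fun s => (G (unitInterval.symm s, 1)).im + Real.pi / 2)
    (by fun_prop)
    (fun s => by rw [Real.cos_add_pi_div_two]; exact neg_pos.2 (hsn _ (ht _)))
    (by rw [Real.sin_add_pi_div_two]; simpa using hcp _ (hr 1))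
    (by rw [Real.sin_add_pi_div_two]; simpa using hcn _ (hl 1))
  have left := lt_of_cos_pos_of_sin (f := fun t => (G (0, unitInterval.symm t)).im + Real.pi)
    (by fun_prop)
    (fun s => by rw [Real.cos_add_pi]; exact neg_pos.2 (hcn _ (hl _)))
    (by rw [Real.sin_add_pi]; simpa using hsn _ (ht 0))
    (by rw [Real.sin_add_pi]; simpa using hsp _ (hb 0))
  have bottom := lt_of_cos_pos_of_sin (f := fun s => (G (s, 0)).im - Real.pi / 2)
    (by fun_prop)
    (fun s => by rw [Real.cos_sub_pi_div_two]; exact hsp _ (hb _))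
    (by rw [Real.sin_sub_pi_div_two]; simpa using hcn _ (hl 0))
    (by rw [Real.sin_sub_pi_div_two]; simpa using hcp _ (hr 0))
  simp only [unitInterval.symm_zero, unitInterval.symm_one] at right top left bottom
  linarith

/-- A continuum crossing a horizontal strip lengthwise meets a continuum crossing a vertical
strip lengthwise. -/
theorem inter_nonempty_of_crossing {P Q : Set ℂ} (hPc : IsCompact P) (hP : IsConnected P)
    (hQc : IsCompact Q) (hQ : IsConnected Q) {R : ℝ} (hPR : ∀ z ∈ P, |z.im| ≤ R)
    (hQR : ∀ z ∈ Q, |z.re| ≤ R) {p₀ p₁ q₀ q₁ : ℂ} (hp₀ : p₀ ∈ P) (hp₁ : p₁ ∈ P) (hq₀ : q₀ ∈ Q)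
    (hq₁ : q₁ ∈ Q) (hp₀R : p₀.re < -(R + 1)) (hp₁R : R + 1 < p₁.re) (hq₀R : q₀.im < -(R + 1))
    (hq₁R : R + 1 < q₁.im) : (P ∩ Q).Nonempty := by
  by_contra hne
  obtain ⟨ε, hε, hdisj⟩ := (Set.disjoint_iff_inter_eq_empty.2
    (Set.not_nonempty_iff_eq_empty.1 hne)).exists_thickenings hPc hQc.isClosed
  set δ := min ε 1 with hδ
  have hδ0 : 0 < δ := lt_min hε one_pos
  have hthick : ∀ {S : Set ℂ}, IsConnected S → IsPathConnected (Metric.thickening δ S) := by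
    intro S hS
    refine (Metric.isOpen_thickening.isConnected_iff_isPathConnected).1 ?_
    rw [← add_ball_zero, ← Set.image2_add, ← Set.image_prod]
    exact (hS.prod (Metric.isConnected_ball hδ0)).image _ (by fun_prop)
  obtain ⟨p, hp⟩ := (hthick hP).joinedIn p₀ (Metric.self_subset_thickening hδ0 _ hp₀) p₁
    (Metric.self_subset_thickening hδ0 _ hp₁)
  obtain ⟨q, hq⟩ := (hthick hQ).joinedIn q₀ (Metric.self_subset_thickening hδ0 _ hq₀) q₁
    (Metric.self_subset_thickening hδ0 _ hq₁)
  have hpb : ∀ s, |(p s).im| < R + 1 := fun s => by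
    obtain ⟨z, hz, hd⟩ := Metric.mem_thickening_iff.1 (hp s)
    have h1 := (abs_im_le_norm (p s - z)).trans_lt (dist_eq_norm (p s) z ▸ hd)
    have h2 := abs_sub_abs_le_abs_sub (p s).im z.im
    rw [sub_im] at h1
    linarith [hPR z hz, min_le_right ε 1]
  have hqb : ∀ s, |(q s).re| < R + 1 := fun s => by
    obtain ⟨z, hz, hd⟩ := Metric.mem_thickening_iff.1 (hq s)
    have h1 := (abs_re_le_norm (q s - z)).trans_lt (dist_eq_norm (q s) z ▸ hd)
    have h2 := abs_sub_abs_le_abs_sub (q s).re z.re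
    rw [sub_re] at h1
    linarith [hQR z hz, min_le_right ε 1]
  obtain ⟨⟨s, t⟩, hst⟩ := exists_zero_of_sign_change ⟨fun x => p x.1 - q x.2, by fun_prop⟩
    (fun t => by have := abs_lt.1 (hqb t); simp; linarith)
    (fun t => by have := abs_lt.1 (hqb t); simp; linarith)
    (fun s => by have := abs_lt.1 (hpb s); simp; linarith)
    (fun s => by have := abs_lt.1 (hpb s); simp; linarith)
  have hst : p s = q t := sub_eq_zero.1 hst
  exact Set.disjoint_left.1 hdisj (Metric.thickening_mono (min_le_left _ _) _ (hp s))
    (hst ▸ Metric.thickening_mono (min_le_left _ _) _ (hq t))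

/-- Finitely many consecutive translates of a continuum by the difference of two of its points
form a continuum. -/
lemma isConnected_iUnion_translates {K : Set ℂ} (hK : IsConnected K) {x u : ℂ} (hx : x ∈ K)
    (hxu : x + u ∈ K) (N : ℕ) :
    IsConnected (⋃ j ∈ Set.Icc (-N : ℤ) N, (fun z : ℂ => z + j * u) '' K) := by
  refine ⟨⟨x, Set.mem_biUnion (x := (0 : ℤ)) (by simp) ⟨x, hx, by simp⟩⟩, ?_⟩
  refine IsPreconnected.biUnion_of_chain Set.ordConnected_Icc
    (fun j _ => hK.isPreconnected.image _ (by fun_prop)) fun j _ _ => ?_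
  refine ⟨x + u + j * u, ⟨x + u, hxu, rfl⟩, ⟨x, hx, ?_⟩⟩
  push_cast [Order.succ_eq_add_one]
  ring

/-- Two planar continua, one joining a point to its translate by `1` and the other joining a
point to its translate by `I`, meet up to a Gaussian integer translation. -/
theorem exists_sub_eq_gaussian {P Q : Set ℂ} (hPc : IsCompact P) (hP : IsConnected P)
    (hQc : IsCompact Q) (hQ : IsConnected Q) {p q : ℂ} (hp : p ∈ P) (hp' : p + 1 ∈ P)
    (hq : q ∈ Q) (hq' : q + I ∈ Q) :
    ∃ x ∈ P, ∃ y ∈ Q, ∃ m n : ℤ, x - y = m + n * I := by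
  obtain ⟨R₁, hR₁⟩ := hPc.isBounded.exists_norm_le
  obtain ⟨R₂, hR₂⟩ := hQc.isBounded.exists_norm_le
  set R := max R₁ R₂
  have hPR : ∀ z ∈ P, ‖z‖ ≤ R := fun z hz => (hR₁ z hz).trans (le_max_left _ _)
  have hQR : ∀ z ∈ Q, ‖z‖ ≤ R := fun z hz => (hR₂ z hz).trans (le_max_right _ _)
  obtain ⟨N, hN⟩ := exists_nat_gt (2 * R + 1)
  have hp₁ := abs_le.1 ((abs_re_le_norm p).trans (hPR p hp))
  have hq₁ := abs_le.1 ((abs_im_le_norm q).trans (hQR q hq))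
  have hcpt : ∀ {K : Set ℂ} (u : ℂ), IsCompact K →
      IsCompact (⋃ j ∈ Set.Icc (-N : ℤ) N, (fun z : ℂ => z + j * u) '' K) := fun u hK =>
    (Set.finite_Icc _ _).isCompact_biUnion fun j _ => hK.image (by fun_prop)
  have hmem : ∀ {K : Set ℂ} (u : ℂ) (j : ℤ) {z : ℂ}, j ∈ Set.Icc (-N : ℤ) N → z ∈ K →
      z + j * u ∈ ⋃ j ∈ Set.Icc (-N : ℤ) N, (fun z : ℂ => z + j * u) '' K := fun u j z hj hz =>
    Set.mem_biUnion hj ⟨z, hz, rfl⟩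
  obtain ⟨z, hzP, hzQ⟩ := inter_nonempty_of_crossing (R := R) (hcpt 1 hPc)
    (isConnected_iUnion_translates hP hp hp' N) (hcpt I hQc)
    (isConnected_iUnion_translates hQ hq hq' N)
    (by
      simp only [Set.mem_iUnion]
      rintro _ ⟨j, -, z, hz, rfl⟩
      simpa using (abs_im_le_norm z).trans (hPR z hz))
    (by
      simp only [Set.mem_iUnion]
      rintro _ ⟨j, -, z, hz, rfl⟩
      simpa using (abs_re_le_norm z).trans (hQR z hz))
    (hmem 1 (-N) (by simp) hp) (hmem 1 N (by simp) hp)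
    (hmem I (-N) (by simp) hq) (hmem I N (by simp) hq)
    (by simp; linarith) (by simp; linarith) (by simp; linarith) (by simp; linarith)
  simp only [Set.mem_iUnion] at hzP hzQ
  obtain ⟨j, -, x, hx, rfl⟩ := hzP
  obtain ⟨k, -, y, hy, h⟩ := hzQ
  refine ⟨x, hx, y, hy, -j, k, ?_⟩
  push_cast
  linear_combination -h

/-- The translates of `a K - K` by the lattice spanned by `a d` and `d` cover the plane, where `d`
is any difference of two points of the continuum `K`. -/
theorem exists_sub_add_lattice_eq {K : Set ℂ} (hKc : IsCompact K) (hK : IsConnected K) {a : ℂ}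
    (ha : a.im ≠ 0) {x₀ x₁ : ℂ} (hx₀ : x₀ ∈ K) (hx₁ : x₁ ∈ K) (hne : x₀ ≠ x₁) (z : ℂ) :
    ∃ x ∈ K, ∃ y ∈ K, ∃ m n : ℤ, a * x - y = z + (m * a + n) * (x₁ - x₀) := by
  have hd : x₁ - x₀ ≠ 0 := sub_ne_zero.2 hne.symm
  set d := x₁ - x₀ with hd_def
  let T : ℂ → ℂ := fun w => (((w / d).im / a.im : ℝ) : ℂ) +
    (((w / d).re - (w / d).im / a.im * a.re : ℝ) : ℂ) * I
  have hTc : Continuous T := by fun_prop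
  have hTadd : ∀ v w, T (v + w) = T v + T w := fun v w => by
    simp only [T, add_div, add_re, add_im]; push_cast; ring
  have hTd : T d = I := by simp [T, div_self hd]
  have hTad : T (a * d) = 1 := by
    have ha' : (a.im : ℂ) ≠ 0 := ofReal_ne_zero.2 ha
    simp [T, mul_div_assoc, div_self hd, div_self ha']
  have hTinv : ∀ w, w = d * ((T w).re * a + (T w).im) := fun w => by
    have h : w / d = (T w).re * a + (T w).im := by
      apply Complex.ext
      · simp [T]
      · simp [T, div_mul_cancel₀ _ ha]
    rw [← h, mul_div_cancel₀ _ hd]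
  obtain ⟨_, ⟨x, hx, rfl⟩, _, ⟨y, hy, rfl⟩, m, n, h⟩ := exists_sub_eq_gaussian
    (hKc.image (f := fun x => T (a * x)) (by fun_prop))
    (hK.image (fun x => T (a * x)) (by fun_prop))
    (hKc.image (f := fun x => T (x + z)) (by fun_prop))
    (hK.image (fun x => T (x + z)) (by fun_prop))
    ⟨x₀, hx₀, rfl⟩ ⟨x₁, hx₁, by rw [← hTad, ← hTadd, hd_def]; ring_nf⟩
    ⟨x₀, hx₀, rfl⟩ ⟨x₁, hx₁, by rw [← hTd, ← hTadd, hd_def]; ring_nf⟩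
  refine ⟨x, hx, y, hy, m, n, ?_⟩
  have h' : T (a * x - y - z) = m + n * I := by
    rw [← h, eq_sub_iff_add_eq, ← hTadd]; ring_nf
  have := hTinv (a * x - y - z)
  rw [h'] at this
  simp at this
  linear_combination this

/-- For a planar continuum `K` and a non-real `a`, the set `a K - K` has non-empty interior. -/
theorem nonempty_interior_mul_sub {K : Set ℂ} (hK : IsContinuum K) {a : ℂ} (ha : a.im ≠ 0) :
    (interior ((fun p : ℂ × ℂ => a * p.1 - p.2) '' K ×ˢ K)).Nonempty := by
  obtain ⟨hKc, hKconn, x₀, hx₀, x₁, hx₁, hne⟩ := hK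
  set C := (fun p : ℂ × ℂ => a * p.1 - p.2) '' K ×ˢ K
  have hC : IsCompact C := (hKc.prod hKc).image (by fun_prop)
  let v : ℤ × ℤ → ℂ := fun i => (i.1 * a + i.2) * (x₁ - x₀)
  obtain ⟨i, w, hw⟩ := nonempty_interior_of_iUnion_of_closed
    (f := fun i => Homeomorph.addRight (v i) ⁻¹' C)
    (fun i => hC.isClosed.preimage (Homeomorph.continuous _)) (by
      refine Set.eq_univ_of_forall fun z => ?_
      obtain ⟨x, hx, y, hy, m, n, h⟩ := exists_sub_add_lattice_eq hKc hKconn ha hx₀ hx₁ hne z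
      exact Set.mem_iUnion.2 ⟨(m, n), (x, y), ⟨hx, hy⟩, h⟩)
  rw [← Homeomorph.preimage_interior] at hw
  exact ⟨_, hw⟩

lemma pr_eq_pr_iff {ω x y : ℂ} : pr ω x = pr ω y ↔ x - y ∈ Lambda ω := by
  rw [← neg_mem_iff, neg_sub, ← neg_add_eq_sub]
  exact QuotientAddGroup.eq

lemma pr_surjective (ω : ℂ) : Function.Surjective (pr ω) := QuotientAddGroup.mk'_surjective _

lemma continuous_pr (ω : ℂ) : Continuous (pr ω) := QuotientAddGroup.continuous_mk

lemma discreteTopology_Lambda {ω : ℂ} (hω : 0 < ω.im) : DiscreteTopology (Lambda ω) := by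
  refine discreteTopology_of_isOpen_singleton_zero ?_
  rw [Metric.isOpen_singleton_iff]
  refine ⟨min 1 ω.im, lt_min one_pos hω, ?_⟩
  rintro ⟨_, n, m, rfl⟩ h
  rw [dist_zero_right] at h
  change ‖(n + m * ω : ℂ)‖ < _ at h
  obtain ⟨h1, h2⟩ := lt_min_iff.1 h
  have him := (abs_im_le_norm _).trans_lt h2
  have hre := (abs_re_le_norm _).trans_lt h1
  simp [abs_mul, abs_of_pos hω] at him
  have hm : m = 0 := by
    rw [← Int.abs_lt_one_iff]
    exact_mod_cast (mul_lt_iff_lt_one_left hω).1 him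
  subst hm
  simp at hre
  have hn : n = 0 := by
    rw [← Int.abs_lt_one_iff]
    exact_mod_cast hre
  subst hn
  ext
  simp

lemma isClosed_Lambda {ω : ℂ} (hω : 0 < ω.im) : IsClosed (Lambda ω : Set ℂ) :=
  have := discreteTopology_Lambda hω
  AddSubgroup.isClosed_of_discrete

lemma isCoveringMap_pr {ω : ℂ} (hω : 0 < ω.im) : IsCoveringMap (pr ω) :=
  have := discreteTopology_Lambda hω
  (AddSubgroup.isAddQuotientCoveringMap_of_comm _ DiscreteTopology.isDiscrete).isCoveringMap

lemma countable_Lambda (ω : ℂ) : (Lambda ω : Set ℂ).Countable := by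
  refine (Set.countable_range fun i : ℤ × ℤ => (i.1 + i.2 * ω : ℂ)).mono ?_
  rintro _ ⟨n, m, rfl⟩
  exact ⟨(n, m), rfl⟩

/-- Countable connected subsets of the torus have at most one point. -/
lemma subsingleton_of_countable {ω : ℂ} (hω : 0 < ω.im) {S : Set (ℂ ⧸ Lambda ω)}
    (hS : S.Countable) (hS' : IsPreconnected S) : S.Subsingleton := by
  have := isClosed_Lambda hω
  let := TopologicalSpace.metrizableSpaceMetric (ℂ ⧸ Lambda ω)
  exact hS.isTotallyDisconnected S subset_rfl hS'

/-- A simply-connected continuum in the torus is the injective image of a planar continuum. -/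
lemma exists_lift {ω : ℂ} (hω : 0 < ω.im) {E : Set (ℂ ⧸ Lambda ω)} (hE : IsContinuum E)
    (hsc : IsSCContinuum ω E) : ∃ K : Set ℂ, IsContinuum K ∧ pr ω '' K = E := by
  obtain ⟨U, hU, hUsc, hEU, -⟩ := hsc
  obtain ⟨hEc, hEconn, hEnt⟩ := hE
  have : LocallyPathConnectedSpace (ℂ ⧸ Lambda ω) :=
    (QuotientAddGroup.isQuotientMap_mk (Lambda ω)).locallyPathConnectedSpace
  have := hU.locallyPathConnectedSpace
  obtain ⟨e, he⟩ := hEconn.nonempty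
  obtain ⟨e₀, he₀⟩ := pr_surjective ω e
  obtain ⟨F, ⟨-, hF⟩, -⟩ := (isCoveringMap_pr hω).existsUnique_continuousMap_lifts
    (⟨Subtype.val, continuous_subtype_val⟩ : C(U, ℂ ⧸ Lambda ω)) ⟨e, hEU he⟩ e₀ he₀
  have hEimg : Subtype.val '' (Subtype.val ⁻¹' E : Set U) = E := by
    rw [Subtype.image_preimage_coe, Set.inter_eq_right.2 hEU]
  have himg : pr ω '' (F '' (Subtype.val ⁻¹' E)) = E := by
    rw [← Set.image_comp, hF]
    exact hEimg
  refine ⟨F '' (Subtype.val ⁻¹' E), ⟨?_, ?_, ?_⟩, himg⟩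
  · exact (Topology.IsInducing.subtypeVal.isCompact_iff.2 (hEimg.symm ▸ hEc)).image F.continuous
  · refine IsConnected.image ⟨⟨⟨e, hEU he⟩, he⟩, ?_⟩ _ F.continuous.continuousOn
    exact Topology.IsInducing.subtypeVal.isPreconnected_image.1
      (hEimg.symm ▸ hEconn.isPreconnected)
  · exact Set.nontrivial_of_image (pr ω) _ (himg.symm ▸ hEnt)

section Dynamics

variable {ω a b : ℂ} {A : ℂ ⧸ Lambda ω → ℂ ⧸ Lambda ω}

lemma continuous_of_semiconj (hA : ∀ z : ℂ, A (pr ω z) = pr ω (a * z + b)) : Continuous A := by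
  refine (QuotientAddGroup.isQuotientMap_mk (N := Lambda ω)).continuous_iff.2 ?_
  have : A ∘ pr ω = fun z => pr ω (a * z + b) := funext hA
  exact this ▸ (continuous_pr ω).comp (by fun_prop)

lemma iterate_pr_eq_iff (hA : ∀ z : ℂ, A (pr ω z) = pr ω (a * z + b)) (n : ℕ) (x y : ℂ) :
    A^[n] (pr ω x) = A^[n] (pr ω y) ↔ a ^ n * (x - y) ∈ Lambda ω := by
  induction n generalizing x y with
  | zero => simp [pr_eq_pr_iff]
  | succ n ih =>
    rw [Function.iterate_succ_apply, Function.iterate_succ_apply, hA, hA, ih]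
    ring_nf

lemma im_ne_zero_of_not_int (h1 : a ∈ Lambda ω) (hω : 0 < ω.im) (h : ¬ ∃ k : ℤ, a = k) :
    a.im ≠ 0 := by
  obtain ⟨n, m, rfl⟩ := h1
  contrapose! h
  refine ⟨n, ?_⟩
  have : m = 0 := by simpa [hω.ne'] using h
  simp [this]

lemma dist_Lambda_le (hω : 0 < ω.im) (z : ℂ) : ∃ l ∈ Lambda ω, ‖z - l‖ ≤ 1 + ‖ω‖ := by
  set m := ⌊z.im / ω.im⌋ with hm
  set n := ⌊z.re - z.im / ω.im * ω.re⌋ with hn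
  refine ⟨n + m * ω, ⟨n, m, rfl⟩, ?_⟩
  have hz : z - (n + m * ω) = (Int.fract (z.re - z.im / ω.im * ω.re) : ℝ) +
      (Int.fract (z.im / ω.im) : ℝ) * ω := by
    apply Complex.ext
    · simp [← Int.self_sub_floor, ← hm, ← hn]; ring
    · simp [← Int.self_sub_floor, ← hm]; field_simp
  rw [hz]
  refine (norm_add_le _ _).trans (add_le_add ?_ ?_)
  · rw [norm_real, Real.norm_of_nonneg (Int.fract_nonneg _)]
    exact (Int.fract_lt_one _).le
  · rw [norm_mul, norm_real, Real.norm_of_nonneg (Int.fract_nonneg _)]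
    exact mul_le_of_le_one_left (norm_nonneg _) (Int.fract_lt_one _).le

lemma exists_pow_mul_mem_Lambda (hω : 0 < ω.im) (ha : 1 < ‖a‖) {O : Set ℂ} (hO : IsOpen O)
    (hne : O.Nonempty) : ∃ z ∈ O, ∃ n : ℕ, a ^ n * z ∈ Lambda ω := by
  obtain ⟨w, hw⟩ := hne
  obtain ⟨ε, hε, hball⟩ := Metric.isOpen_iff.1 hO w hw
  obtain ⟨n, hn⟩ := pow_unbounded_of_one_lt ((1 + ‖ω‖) / ε) ha
  obtain ⟨l, hl, hd⟩ := dist_Lambda_le hω (a ^ n * w)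
  have hpos : 0 < ‖a‖ ^ n := by positivity
  have ha0 : a ^ n ≠ 0 := by rw [← norm_pos_iff, norm_pow]; exact hpos
  refine ⟨l / a ^ n, hball ?_, n, by rwa [mul_div_cancel₀ _ ha0]⟩
  have : w - l / a ^ n = (a ^ n * w - l) / a ^ n := by field_simp
  rw [Metric.mem_ball, dist_comm, dist_eq_norm, this, norm_div, norm_pow, div_lt_iff₀ hpos]
  rw [div_lt_iff₀ hε] at hn
  linarith

lemma Wandering.image_iterate {X : Type*} {A : X → X} {E : Set X} (h : Wandering A E) (N : ℕ) :
    Wandering A (A^[N] '' E) := by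
  intro n m hnm
  rw [← Set.image_comp, ← Set.image_comp, ← Function.iterate_add, ← Function.iterate_add]
  exact h _ _ (by omega)

lemma IsContinuum.image_iterate (hω : 0 < ω.im) (ha : a ≠ 0)
    (hA : ∀ z : ℂ, A (pr ω z) = pr ω (a * z + b)) {E : Set (ℂ ⧸ Lambda ω)} (hE : IsContinuum E)
    (N : ℕ) : IsContinuum (A^[N] '' E) := by
  have hc : Continuous A^[N] := (continuous_of_semiconj hA).iterate N
  refine ⟨hE.1.image hc, hE.2.1.image _ hc.continuousOn, ?_⟩
  rw [← Set.not_subsingleton_iff]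
  intro hs
  refine Set.not_subsingleton_iff.2 hE.2.2
    (subsingleton_of_countable hω ?_ hE.2.1.isPreconnected)
  obtain ⟨e, he⟩ := hE.2.1.nonempty
  obtain ⟨x, rfl⟩ := pr_surjective ω e
  refine ((countable_Lambda ω).image fun l => pr ω (x + l / a ^ N)).mono fun f hf => ?_
  obtain ⟨y, rfl⟩ := pr_surjective ω f
  refine ⟨a ^ N * (y - x), (iterate_pr_eq_iff hA N y x).1
    (hs (Set.mem_image_of_mem _ hf) (Set.mem_image_of_mem _ he)), ?_⟩
  simp only
  rw [mul_div_cancel_left₀ _ (pow_ne_zero _ ha), add_sub_cancel]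

/-- If the multiplier is not real, no planar continuum projects to a wandering set. -/
theorem not_wandering_image_pr (hω : 0 < ω.im) (ha : 1 < ‖a‖) (him : a.im ≠ 0)
    (hA : ∀ z : ℂ, A (pr ω z) = pr ω (a * z + b)) {K : Set ℂ} (hK : IsContinuum K) :
    ¬ Wandering A (pr ω '' K) := by
  intro hW
  obtain ⟨z, hz, n, hn⟩ := exists_pow_mul_mem_Lambda hω ha
    (isOpen_interior.preimage (continuous_sub_right b))
    ((nonempty_interior_mul_sub hK him).preimage fun z => ⟨z + b, add_sub_cancel_right z b⟩)
  obtain ⟨⟨x, y⟩, ⟨hx, hy⟩, hxy⟩ := interior_subset hz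
  have hz' : z = a * x + b - y := by
    have : a * x - y = z - b := hxy
    linear_combination -this
  rw [hz', ← iterate_pr_eq_iff hA, ← hA, ← Function.iterate_succ_apply] at hn
  refine Set.notMem_empty (A^[n] (pr ω y)) (hW (n + 1) n n.lt_succ_self ▸ ⟨?_, ?_⟩)
  · exact hn ▸ Set.mem_image_of_mem _ (Set.mem_image_of_mem _ hx)
  · exact Set.mem_image_of_mem _ (Set.mem_image_of_mem _ hy)

end Dynamics

lemma sq_sub_two_mul_sq_ne_zero {n m : ℤ} (hn : n ≠ 0) : (m ^ 2 - 2 * n ^ 2 : ℤ) ≠ 0 := by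
  intro h
  have h' : (m : ℝ) ^ 2 = 2 * n ^ 2 := by exact_mod_cast sub_eq_zero.1 h
  have hn' : (n : ℝ) ≠ 0 := Int.cast_ne_zero.2 hn
  have hs : √2 = |((m / n : ℚ) : ℝ)| := by
    rw [← Real.sqrt_sq_eq_abs]
    congr 1
    push_cast
    rw [div_pow, h', mul_div_cancel_right₀ _ (pow_ne_zero 2 hn')]
  exact irrational_sqrt_two ⟨|(m / n : ℚ)|, by rw [hs]; norm_cast⟩

lemma exists_unique_coords {ω : ℂ} (hω : 0 < ω.im) {x y x' y' : ℝ}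
    (h : (x + y * ω : ℂ) = x' + y' * ω) : x = x' ∧ y = y' := by
  have hy : y = y' := by
    have := congrArg im h
    simpa [hω.ne'] using this
  subst hy
  exact ⟨by simpa using h, rfl⟩

/-- A thin box around a segment of slope `√2` contains no two points differing by a non-zero
lattice vector. -/
lemma exists_thin_box {ω : ℂ} (hω : 0 < ω.im) {L : ℝ} (hL : L ≠ 0) :
    ∃ δ > 0, ∀ x y : ℝ, |x| ≤ 3 → |y| < 2 * δ →
      (x * L * (1 + √2 * ω) + y * ω : ℂ) ∈ Lambda ω → x = 0 ∧ y = 0 := by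
  set M := 3 * |L| with hM
  have hM0 : 0 ≤ M := by positivity
  refine ⟨1 / (2 * (4 * M + 5)), by positivity, fun x y hx hy hmem => ?_⟩
  obtain ⟨n, m, h⟩ := hmem
  have hy' : |y| * (4 * M + 5) < 1 := by
    rw [← lt_div_iff₀ (by positivity)]
    exact hy.trans_eq (by field_simp)
  obtain ⟨hn, hm⟩ := exists_unique_coords hω (x := x * L) (y := x * L * √2 + y) (x' := n)
    (y' := m) (by push_cast; rw [← h]; ring)
  rw [hn] at hm
  have hy1 : |y| < 1 := by nlinarith [abs_nonneg y]
  rcases eq_or_ne n 0 with rfl | hn0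
  · have hm0 : m = 0 := by
      rw [← Int.abs_lt_one_iff]
      have : y = m := by simpa using hm
      rw [this] at hy1
      exact_mod_cast hy1
    subst hm0
    exact ⟨by simpa [hL] using hn, by simpa using hm⟩
  · exfalso
    have hnM : |(n : ℝ)| ≤ M := by
      rw [← hn, abs_mul]
      exact mul_le_mul_of_nonneg_right hx (abs_nonneg _)
    have hs2 : √2 ≤ 3 / 2 := by
      rw [Real.sqrt_le_left (by norm_num)]; norm_num
    have hsum : |(m + √2 * n : ℝ)| ≤ 4 * M + 5 := by
      have : (m + √2 * n : ℝ) = y + 2 * √2 * n := by rw [← hm]; ring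
      rw [this]
      refine (abs_add_le _ _).trans ?_
      rw [abs_mul, abs_of_nonneg (by positivity : 0 ≤ 2 * √2)]
      nlinarith [mul_le_mul hs2 hnM (abs_nonneg _) (by norm_num)]
    have hprod : |((m ^ 2 - 2 * n ^ 2 : ℤ) : ℝ)| < 1 := by
      have : ((m ^ 2 - 2 * n ^ 2 : ℤ) : ℝ) = y * (m + √2 * n) := by
        have hy2 : y = m - √2 * n := by rw [← hm]; ring
        have hs := Real.sq_sqrt (zero_le_two (α := ℝ))
        push_cast
        rw [hy2]
        linear_combination (n : ℝ) ^ 2 * hs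
      rw [this, abs_mul]
      exact (mul_le_mul_of_nonneg_left hsum (abs_nonneg _)).trans_lt hy'
    exact sq_sub_two_mul_sq_ne_zero hn0 (Int.abs_lt_one_iff.1 (by exact_mod_cast hprod))

lemma isConnected_box_diff_segment {δ : ℝ} (hδ : 0 < δ) :
    IsConnected ((Set.Ioo (-1 : ℝ) 2 ×ˢ Set.Ioo (-δ) δ) \ (Set.Icc (0 : ℝ) 1 ×ˢ {(0 : ℝ)})) := by
  have hbox : ∀ {p q r s : ℝ}, p < q → r < s → IsConnected (Set.Ioo p q ×ˢ Set.Ioo r s) :=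
    fun h h' => (isConnected_Ioo h).prod (isConnected_Ioo h')
  have heq : (Set.Ioo (-1 : ℝ) 2 ×ˢ Set.Ioo (-δ) δ) \ (Set.Icc (0 : ℝ) 1 ×ˢ {(0 : ℝ)}) =
      ((Set.Ioo (-1) 2 ×ˢ Set.Ioo 0 δ ∪ Set.Ioo (-1) 0 ×ˢ Set.Ioo (-δ) δ) ∪
        Set.Ioo (-1) 2 ×ˢ Set.Ioo (-δ) 0) ∪ Set.Ioo 1 2 ×ˢ Set.Ioo (-δ) δ := by
    ext ⟨x, y⟩
    simp only [Set.mem_sdiff, Set.mem_prod, Set.mem_Ioo, Set.mem_Icc, Set.mem_singleton_iff,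
      Set.mem_union]
    constructor
    · rintro ⟨⟨⟨h1, h2⟩, h3, h4⟩, h5⟩
      rcases lt_trichotomy y 0 with hy | hy | hy
      · exact .inl (.inr ⟨⟨h1, h2⟩, h3, hy⟩)
      · by_cases hx : x < 0
        · exact .inl (.inl (.inr ⟨⟨h1, hx⟩, h3, h4⟩))
        · exact .inr ⟨⟨not_le.1 fun hx1 => h5 ⟨⟨not_lt.1 hx, hx1⟩, hy⟩, h2⟩, h3, h4⟩
      · exact .inl (.inl (.inl ⟨⟨h1, h2⟩, hy, h4⟩))
    · rintro (((⟨⟨h1, h2⟩, h3, h4⟩ | ⟨⟨h1, h2⟩, h3, h4⟩) | ⟨⟨h1, h2⟩, h3, h4⟩) |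
        ⟨⟨h1, h2⟩, h3, h4⟩) <;>
      exact ⟨⟨⟨by linarith, by linarith⟩, by linarith, by linarith⟩,
        fun ⟨⟨_, _⟩, _⟩ => by linarith⟩
  rw [heq]
  refine (((hbox (by norm_num) hδ).union ?_ (hbox (by norm_num) (by linarith))).union ?_
    (hbox (by norm_num) (by linarith))).union ?_ (hbox (by norm_num) (by linarith))
  · exact ⟨(-1 / 2, δ / 2), by constructor <;> constructor <;> constructor <;> simp <;> linarith⟩
  · exact ⟨(-1 / 2, -δ / 2), .inr (by constructor <;> constructor <;> simp <;> linarith),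
      by constructor <;> constructor <;> simp <;> linarith⟩
  · exact ⟨(3 / 2, δ / 2), .inl (.inl (by constructor <;> constructor <;> norm_num <;> linarith)),
      by constructor <;> constructor <;> norm_num <;> linarith⟩

/-- Affine coordinates on `ℂ` with axes spanned by `L (1 + √2 ω)` and `ω`. -/
noncomputable def segmentCoords {ω : ℂ} (hω : 0 < ω.im) (c : ℂ) {L : ℝ} (hL : L ≠ 0) :
    ℝ × ℝ ≃ₜ ℂ where
  toFun p := c + (p.1 * L * (1 + √2 * ω) + p.2 * ω)
  invFun z := (((z - c).re - (z - c).im / ω.im * ω.re) / L,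
    (z - c).im / ω.im - √2 * ((z - c).re - (z - c).im / ω.im * ω.re))
  left_inv p := by
    have := hω.ne'
    ext
    · simp; field_simp; ring
    · simp; field_simp; ring
  right_inv z := by
    have := hω.ne'
    apply Complex.ext
    · simp; field_simp; ring
    · simp; field_simp; ring
  continuous_toFun := by fun_prop
  continuous_invFun := by fun_prop

lemma segmentCoords_apply {ω : ℂ} (hω : 0 < ω.im) (c : ℂ) {L : ℝ} (hL : L ≠ 0) (p : ℝ × ℝ) :
    segmentCoords hω c hL p = c + (p.1 * L * (1 + √2 * ω) + p.2 * ω) := rfl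

/-- The image in the torus of a segment of slope `√2`. -/
def torusSegment (ω c : ℂ) (L : ℝ) : Set (ℂ ⧸ Lambda ω) :=
  (fun t : ℝ => pr ω (c + t * L * (1 + √2 * ω))) '' Set.Icc 0 1

lemma isContinuum_torusSegment {ω : ℂ} (hω : 0 < ω.im) (c : ℂ) {L : ℝ} (hL : L ≠ 0) :
    IsContinuum (torusSegment ω c L) := by
  have hc : Continuous fun t : ℝ => pr ω (c + t * L * (1 + √2 * ω)) :=
    (continuous_pr ω).comp (by fun_prop)
  refine ⟨isCompact_Icc.image hc, (isConnected_Icc zero_le_one).image _ hc.continuousOn,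
    _, ⟨0, by simp, rfl⟩, _, ⟨1, by simp, rfl⟩, fun h => ?_⟩
  obtain ⟨δ, hδ, hbox⟩ := exists_thin_box hω hL
  have := (hbox (-1) 0 (by norm_num) (by simpa using hδ) (by
    convert pr_eq_pr_iff.1 h using 1
    push_cast
    ring)).1
  norm_num at this

lemma isSCContinuum_torusSegment {ω : ℂ} (hω : 0 < ω.im) (c : ℂ) {L : ℝ} (hL : L ≠ 0) :
    IsSCContinuum ω (torusSegment ω c L) := by
  obtain ⟨δ, hδ, hbox⟩ := exists_thin_box hω hL
  set B : Set (ℝ × ℝ) := Set.Ioo (-1) 2 ×ˢ Set.Ioo (-δ) δ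
  set f : ℝ × ℝ → ℂ ⧸ Lambda ω := pr ω ∘ segmentCoords hω c hL with hf
  have hBo : IsOpen B := isOpen_Ioo.prod isOpen_Ioo
  have hfc : Continuous f := (continuous_pr ω).comp (Homeomorph.continuous _)
  have hfo : IsOpenMap f :=
    IsOpenMap.comp QuotientAddGroup.isOpenMap_coe (Homeomorph.isOpenMap _)
  have hinj : Set.InjOn f B := by
    rintro ⟨x, y⟩ ⟨⟨h1, h2⟩, h3, h4⟩ ⟨x', y'⟩ ⟨⟨h1', h2'⟩, h3', h4'⟩ h
    simp only at h1 h2 h3 h4 h1' h2' h3' h4'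
    obtain ⟨hx, hy⟩ := hbox (x - x') (y - y') (abs_le.2 ⟨by linarith, by linarith⟩)
      (abs_lt.2 ⟨by linarith, by linarith⟩) (by
        convert pr_eq_pr_iff.1 h using 1
        simp only [segmentCoords_apply]
        push_cast
        ring)
    rw [sub_eq_zero.1 hx, sub_eq_zero.1 hy]
  have hSB : Set.Icc (0 : ℝ) 1 ×ˢ {(0 : ℝ)} ⊆ B := by
    rintro ⟨x, y⟩ ⟨⟨h1, h2⟩, rfl : y = 0⟩
    simp only at h1 h2
    exact ⟨⟨by linarith, by linarith⟩, by simpa using hδ, hδ⟩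
  have hE : torusSegment ω c L = f '' (Set.Icc (0 : ℝ) 1 ×ˢ {(0 : ℝ)}) := by
    ext z
    simp [torusSegment, hf, segmentCoords_apply]
  refine ⟨f '' B, hfo _ hBo, ?_, hE ▸ Set.image_mono hSB, ?_⟩
  · have hemb : Topology.IsOpenEmbedding (B.domRestrict f) :=
      .of_continuous_injective_isOpenMap (hfc.comp continuous_subtype_val) hinj.injective
        (hfo.comp hBo.isOpenMap_subtype_val)
    have hB : ContractibleSpace B :=
      ((convex_Ioo _ _).prod (convex_Ioo _ _)).contractibleSpace
        ⟨(0, 0), by simp [B, hδ]⟩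
    rw [← Set.range_domRestrict]
    have : ContractibleSpace (Set.range (B.domRestrict f)) :=
      hemb.isEmbedding.toHomeomorph.symm.contractibleSpace
    infer_instance
  · rw [hE, ← hinj.image_sdiff_subset hSB]
    exact (isConnected_box_diff_segment hδ).image _ hfc.continuousOn

lemma exists_mul_notMem_span : ∃ s : ℝ, ∀ N p q : ℤ, N ≠ 0 → N * s + √2 * p ≠ q := by
  by_contra! h
  refine Set.not_countable_univ (α := ℝ) ((Set.countable_range
    fun i : ℤ × ℤ × ℤ => ((i.1 - √2 * i.2.1) / i.2.2 : ℝ)).mono fun s _ => ?_)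
  obtain ⟨N, p, q, hN, hs⟩ := h s
  refine ⟨(q, p, N), ?_⟩
  have : (N : ℝ) ≠ 0 := Int.cast_ne_zero.2 hN
  simp only
  rw [div_eq_iff this, ← hs]
  ring

/-- An integer multiplier of modulus at least two admits a wandering segment, all of whose
iterates are simply-connected. -/
theorem exists_wandering_segment {ω b : ℂ} (hω : 0 < ω.im) {k : ℤ} (hk : 2 ≤ k.natAbs)
    {A : ℂ ⧸ Lambda ω → ℂ ⧸ Lambda ω} (hA : ∀ z : ℂ, A (pr ω z) = pr ω (k * z + b)) :
    ∃ E : Set (ℂ ⧸ Lambda ω), IsContinuum E ∧ Wandering A E ∧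
      ∀ n, IsSCContinuum ω (A^[n] '' E) := by
  obtain ⟨s, hs⟩ := exists_mul_notMem_span
  have hk1 : (1 - k : ℂ) ≠ 0 := by
    rw [sub_ne_zero]
    intro h
    have h' : 1 = k := by exact_mod_cast h
    simp [← h'] at hk
  obtain ⟨z₀, hz₀⟩ : ∃ z₀ : ℂ, k * z₀ + b = z₀ :=
    ⟨b / (1 - k), by field_simp; ring⟩
  have hiter : ∀ n z, A^[n] (pr ω (z₀ + z)) = pr ω (z₀ + k ^ n * z) := by
    intro n
    induction n with
    | zero => simp
    | succ n ih =>
      intro z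
      rw [Function.iterate_succ_apply', ih, hA]
      congr 1
      linear_combination hz₀
  have himg : ∀ n, A^[n] '' torusSegment ω (z₀ + s * ω) 1 =
      torusSegment ω (z₀ + k ^ n * (s * ω)) (k ^ n) := by
    intro n
    rw [torusSegment, torusSegment, Set.image_image]
    refine Set.image_congr fun t _ => ?_
    rw [add_assoc, hiter]
    congr 1
    push_cast
    ring
  have hk0 : (k : ℝ) ≠ 0 := Int.cast_ne_zero.2 (by rintro rfl; simp at hk)
  refine ⟨torusSegment ω (z₀ + s * ω) 1, isContinuum_torusSegment hω _ one_ne_zero, ?_, fun n => ?_⟩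
  · intro n m hnm
    rw [himg, himg, Set.eq_empty_iff_forall_notMem]
    rintro _ ⟨⟨t, -, rfl⟩, t', -, h⟩
    obtain ⟨p, q, h⟩ := pr_eq_pr_iff.1 h.symm
    obtain ⟨h1, h2⟩ := exists_unique_coords hω (x := t * k ^ n - t' * k ^ m)
      (y := (k ^ n - k ^ m) * s + √2 * (t * k ^ n - t' * k ^ m)) (x' := p) (y' := q)
      (by rw [ofReal_intCast, ofReal_intCast, ← h]; push_cast; ring)
    rw [h1] at h2
    refine hs (k ^ n - k ^ m) p q (sub_ne_zero.2 fun h => ?_) (by exact_mod_cast h2)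
    have := congrArg Int.natAbs h
    rw [Int.natAbs_pow, Int.natAbs_pow] at this
    exact hnm.ne' (Nat.pow_right_injective hk this)
  · rw [himg]
    exact isSCContinuum_torusSegment hω _ (pow_ne_zero n hk0)

/-- A Lattès-type torus covering admits an eventually simply-connected wandering
continuum iff its derivative is an integer. -/
theorem torus_wandering_iff_integer (ω a b : ℂ) (hω : 0 < ω.im)
    (hab : ∀ z ∈ Lambda ω, a * z ∈ Lambda ω)
    (hdeg : 2 ≤ Complex.normSq a)
    (A : ℂ ⧸ Lambda ω → ℂ ⧸ Lambda ω)
    (hA : ∀ z : ℂ, A (pr ω z) = pr ω (a * z + b)) :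
    (∃ E : Set (ℂ ⧸ Lambda ω), IsContinuum E ∧ Wandering A E ∧
        ∃ N : ℕ, ∀ n ≥ N, IsSCContinuum ω (A^[n] '' E)) ↔
      ∃ k : ℤ, a = (k : ℂ) := by
  have h1 : 1 < ‖a‖ := by
    rw [normSq_eq_norm_sq] at hdeg
    nlinarith [norm_nonneg a]
  constructor
  · rintro ⟨E, hE, hW, N, hN⟩
    by_contra hint
    have h1Λ : a ∈ Lambda ω := by simpa using hab 1 ⟨1, 0, by simp⟩
    obtain ⟨K, hK, hKE⟩ := exists_lift hω
      (hE.image_iterate hω (norm_pos_iff.1 (one_pos.trans h1)) hA N) (hN N le_rfl)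
    exact not_wandering_image_pr hω h1 (im_ne_zero_of_not_int h1Λ hω hint) hA hK
      (hKE ▸ hW.image_iterate N)
  · rintro ⟨k, rfl⟩
    have hk : 2 ≤ k.natAbs := by
      rw [norm_intCast, ← Int.cast_abs, Int.abs_eq_natAbs] at h1
      exact_mod_cast h1
    obtain ⟨E, hE, hW, hsc⟩ := exists_wandering_segment hω hk hA
    exact ⟨E, hE, hW, 0, fun n _ => hsc n⟩
end

section
/- Let ω ∈ ℂ with Im ω > 0, let Λ = {n + m·ω : n, m ∈ ℤ} ⊂ ℂ, and let a, b ∈ ℂ satisfy a·Λ ⊆ Λ and |a|² ≥ 2. Let A : ℂ/Λ → ℂ/Λ be the map induced by z ↦ a·z + b. If a is not real, then no line segment in ℂ/Λ is wandering: for every nondegenerate line segment B ⊂ ℂ on which the quotient map π is injective, there exist integers n > m ≥ 0 such that Aⁿ(π(B)) ∩ Aᵐ(π(B)) ≠ ∅. -/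
open Complex

/-- Every complex number is within a bounded distance of the lattice. -/
theorem exists_mem_Lambda_norm_sub_le {ω : ℂ} (hω : 0 < ω.im) (z : ℂ) :
    ∃ w ∈ Lambda ω, ‖w - z‖ ≤ 1 + ω.im := by
  set m : ℤ := ⌊z.im / ω.im⌋
  set n : ℤ := ⌊z.re - m * ω.re⌋
  have hm₁ : m * ω.im ≤ z.im := (le_div_iff₀ hω).mp (Int.floor_le _)
  have hm₂ : z.im < (m + 1) * ω.im := (div_lt_iff₀ hω).mp (Int.lt_floor_add_one _)
  have hn₁ : n ≤ z.re - m * ω.re := Int.floor_le _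
  have hn₂ : z.re - m * ω.re < n + 1 := Int.lt_floor_add_one _
  refine ⟨n + m * ω, ⟨n, m, rfl⟩, (norm_le_abs_re_add_abs_im _).trans (add_le_add ?_ ?_)⟩
  · simp only [sub_re, add_re, mul_re, intCast_re, intCast_im, zero_mul, sub_zero]
    rw [abs_le]
    constructor <;> linarith
  · simp only [sub_im, add_im, mul_im, intCast_re, intCast_im, zero_mul, add_zero, zero_add]
    rw [abs_le]
    constructor <;> linarith

/-- If `a` is not real, the parallelogram `{t * a - s : t, s ∈ [0, 1]}` contains a disk around its
centre. -/
theorem exists_forall_norm_le_exists_mul_sub_eq {a : ℂ} (ha : a.im ≠ 0) :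
    ∃ ε : ℝ, 0 < ε ∧ ∀ u : ℂ, ‖u‖ ≤ ε → ∃ t ∈ Set.Icc (0 : ℝ) 1, ∃ s ∈ Set.Icc (0 : ℝ) 1,
      (t : ℂ) * a - s = (a - 1) / 2 + u := by
  have ha' : 0 < |a.im| := abs_pos.mpr ha
  have hpos : 0 < |a.re| + |a.im| + 1 := by positivity
  refine ⟨|a.im| / (2 * (|a.re| + |a.im| + 1)), by positivity, fun u hu => ?_⟩
  rw [le_div_iff₀ (by positivity)] at hu
  have hu_re := abs_re_le_norm u
  have hu_im := abs_im_le_norm u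
  have ht : |u.im / a.im| ≤ 1 / 2 := by
    rw [abs_div, div_le_iff₀ ha']
    nlinarith [norm_nonneg u, abs_nonneg a.re]
  have hs : |u.im / a.im * a.re - u.re| ≤ 1 / 2 := by
    have hmul : |u.im / a.im * a.re - u.re| * |a.im| ≤ 1 / 2 * |a.im| := by
      rw [← abs_mul, show (u.im / a.im * a.re - u.re) * a.im = u.im * a.re - u.re * a.im by
        field_simp]
      refine (abs_sub _ _).trans ?_
      rw [abs_mul, abs_mul]
      nlinarith [norm_nonneg u, mul_le_mul_of_nonneg_right hu_im (abs_nonneg a.re),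
        mul_le_mul_of_nonneg_right hu_re (abs_nonneg a.im)]
    exact le_of_mul_le_mul_right hmul ha'
  rw [abs_le] at ht hs
  refine ⟨1 / 2 + u.im / a.im, ⟨by linarith, by linarith⟩,
    1 / 2 + (u.im / a.im * a.re - u.re), ⟨by linarith, by linarith⟩, ?_⟩
  apply Complex.ext
  · simp
    ring
  · simp
    field_simp

theorem iterate_affine_add (a b z w : ℂ) (n : ℕ) :
    (fun x => a * x + b)^[n] (z + w) = (fun x => a * x + b)^[n] z + a ^ n * w := by
  induction n with
  | zero => simp
  | succ n ih =>
    simp only [Function.iterate_succ_apply', ih]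
    ring

/-- Lemma 3.4 (non-wandering): if the derivative a is not real, then no line segment
in the torus is wandering. -/
theorem segment_not_wandering_of_not_real (ω a b : ℂ) (hω : 0 < ω.im)
    (hab : ∀ z ∈ Lambda ω, a * z ∈ Lambda ω)
    (hdeg : 2 ≤ Complex.normSq a)
    (A : ℂ ⧸ Lambda ω → ℂ ⧸ Lambda ω)
    (hA : ∀ z : ℂ, A (pr ω z) = pr ω (a * z + b))
    (ha : a.im ≠ 0)
    (B : Set ℂ) (hB : IsSegment B) (hinj : Set.InjOn (pr ω) B) :
    ∃ n m : ℕ, m < n ∧ (A^[n] '' (pr ω '' B) ∩ A^[m] '' (pr ω '' B)).Nonempty := by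
  obtain ⟨z₀, v, hv, rfl⟩ := hB
  obtain ⟨ε, hε, hdisk⟩ := exists_forall_norm_le_exists_mul_sub_eq ha
  have ha₁ : 1 < ‖a‖ := by
    rw [normSq_eq_norm_sq] at hdeg
    nlinarith [norm_nonneg a]
  have ha₀ : a ≠ 0 := norm_pos_iff.mp (one_pos.trans ha₁)
  have hvε : 0 < ε * ‖v‖ := mul_pos hε (norm_pos_iff.mpr hv)
  obtain ⟨m, hm⟩ := pow_unbounded_of_one_lt ((1 + ω.im) / (ε * ‖v‖)) ha₁
  rw [div_lt_iff₀ hvε] at hm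
  have hiter (n : ℕ) (z : ℂ) : A^[n] (pr ω z) = pr ω ((fun x => a * x + b)^[n] z) :=
    ((Function.Semiconj.iterate_right (f := pr ω) (fun z => (hA z).symm) n) z).symm
  set d := (fun x => a * x + b)^[m + 1] z₀ - (fun x => a * x + b)^[m] z₀ with hd
  have hc : a ^ m * v ≠ 0 := mul_ne_zero (pow_ne_zero _ ha₀) hv
  obtain ⟨l, hl, hnear⟩ := exists_mem_Lambda_norm_sub_le hω (d + a ^ m * v * ((a - 1) / 2))
  obtain ⟨t, ht, s, hs, hts⟩ := hdisk ((l - (d + a ^ m * v * ((a - 1) / 2))) / (a ^ m * v)) (by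
    rw [norm_div, div_le_iff₀ (norm_pos_iff.mpr hc), norm_mul, norm_pow]
    linarith)
  have hl' : l = d + a ^ m * v * (t * a - s) := by
    rw [hts]
    field_simp
    ring
  refine ⟨m + 1, m, m.lt_succ_self, A^[m + 1] (pr ω (z₀ + t * v)),
    ⟨_, ⟨_, ⟨t, ht, rfl⟩, rfl⟩, rfl⟩, ⟨_, ⟨_, ⟨s, hs, rfl⟩, rfl⟩, ?_⟩⟩
  rw [hiter, hiter, iterate_affine_add, iterate_affine_add]
  refine QuotientAddGroup.eq.mpr ?_
  convert hl using 1
  rw [hl', hd]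
  ring
end

section
/- Let ω ∈ ℂ with Im ω > 0, let Λ = {n + m·ω : n, m ∈ ℤ} ⊂ ℂ, and let a ∈ ℂ \ ℝ satisfy a·Λ ⊆ Λ. Then ω is a quadratic irrationality: there exist integers q, t, r with q ≠ 0 such that q·ω² + t·ω + r = 0. -/
open Complex

/-- If a non-real complex number a satisfies a·Λ ⊆ Λ, then ω is a quadratic
irrationality: q·ω² + t·ω + r = 0 for some integers q ≠ 0, t, r. -/
theorem omega_quadratic_of_nonreal_multiplier (ω : ℂ) (hω : 0 < ω.im) (a : ℂ)
    (ha : a.im ≠ 0)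
    (hab : ∀ z ∈ Lambda ω, a * z ∈ Lambda ω) :
    ∃ q t r : ℤ, q ≠ 0 ∧ (q : ℂ) * ω ^ 2 + (t : ℂ) * ω + (r : ℂ) = 0 := by
  obtain ⟨n, m, h₁⟩ := hab 1 ⟨1, 0, by simp⟩
  obtain ⟨k, l, h₂⟩ := hab ω ⟨0, 1, by simp⟩
  rw [mul_one] at h₁
  refine ⟨m, n - l, -k, ?_, ?_⟩
  · rintro rfl
    exact ha (by simp [h₁])
  · rw [h₁] at h₂
    push_cast
    linear_combination h₂
end

section
/- Let ω ∈ ℂ with Im ω > 0, let Λ = {n + m·ω : n, m ∈ ℤ} ⊂ ℂ, and let z₀ ∈ ℂ. Let L ⊂ ℂ be a line such that L ∩ (z₀ + (1/2)Λ) = {z₀}, i.e., z₀ is the unique point z ∈ L with 2·(z − z₀) ∈ Λ. Then the quotient map π : ℂ → ℂ/Λ is injective on L: no two distinct points of L differ by an element of Λ. -/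
open Complex

/-- A line meeting the half-lattice translates of z₀ only at z₀ projects injectively
to the torus. -/
theorem proj_injective_on_line_through_one_half_lattice_point (ω z₀ : ℂ)
    (hω : 0 < ω.im) (L : Set ℂ) (hL : IsLine L)
    (hz : L ∩ {z : ℂ | 2 * (z - z₀) ∈ Lambda ω} = {z₀}) :
    Set.InjOn (pr ω) L := by
  obtain ⟨w, v, -, rfl⟩ := hL
  have hz₀ : z₀ ∈ {z | ∃ t : ℝ, z = w + t * v} := (hz.ge rfl).1
  obtain ⟨r, hr⟩ := hz₀
  rintro x ⟨s, hs⟩ y ⟨t, ht⟩ hxy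
  have hΛ : -x + y ∈ Lambda ω := QuotientAddGroup.eq.mp hxy
  have hmem : z₀ + (-x + y) ∈ ({z₀} : Set ℂ) := by
    rw [← hz]
    refine ⟨⟨r - s + t, ?_⟩, ?_⟩
    · rw [hr, hs, ht]
      push_cast
      ring
    · have h := add_mem hΛ hΛ
      rwa [← two_mul, ← add_sub_cancel_left z₀ (-x + y)] at h
  have h : z₀ + (-x + y) = z₀ := hmem
  linear_combination -h
end

section
/- Let B ⊆ ℂ be a closed set and let x, y ∈ B be distinct points such that the open segment {x + t·(y − x) : t ∈ (0,1)} is not contained in B. Let L = {x + t·(y − x) : t ∈ ℝ} be the line through x and y. Then L \ B has a bounded connected component. -/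
/-- A preconnected set of reals meeting an open interval but missing both of its endpoints
is contained in the interval. -/
theorem IsPreconnected.subset_Ioo_of_endpoints_notMem {s : Set ℝ} (hs : IsPreconnected s)
    {a b t : ℝ} (ht : t ∈ s) (hat : a < t) (htb : t < b) (ha : a ∉ s) (hb : b ∉ s) :
    s ⊆ Set.Ioo a b := by
  intro u hu
  constructor
  · by_contra! h
    exact ha (hs.ordConnected.out hu ht ⟨h, hat.le⟩)
  · by_contra! h
    exact hb (hs.ordConnected.out ht hu ⟨htb.le, h⟩)

/-- If a closed set B contains two points x ≠ y but not the whole open segment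
between them, then the complement of B in the line through x and y has a bounded
connected component. -/
theorem bounded_component_of_line_diff (B : Set ℂ) (hB : IsClosed B)
    (x y : ℂ) (hx : x ∈ B) (hy : y ∈ B) (hxy : x ≠ y)
    (hseg : ¬ ({z : ℂ | ∃ t : ℝ, t ∈ Set.Ioo (0 : ℝ) 1 ∧ z = x + t * (y - x)} ⊆ B)) :
    ∃ w ∈ ({z : ℂ | ∃ t : ℝ, z = x + t * (y - x)} \ B),
      Bornology.IsBounded
        (connectedComponentIn ({z : ℂ | ∃ t : ℝ, z = x + t * (y - x)} \ B) w) := by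
  obtain ⟨w, ⟨t, ht, hwt⟩, hwB⟩ := Set.not_subset.mp hseg
  set S := {z : ℂ | ∃ t : ℝ, z = x + t * (y - x)} \ B
  have hwS : w ∈ S := ⟨⟨t, hwt⟩, hwB⟩
  refine ⟨w, hwS, ?_⟩
  have hne : y - x ≠ 0 := sub_ne_zero.mpr hxy.symm
  let f : ℂ → ℝ := fun z => ((z - x) / (y - x)).re
  have hf : Continuous f := by fun_prop
  have hf_param (s : ℝ) : f (x + s * (y - x)) = s := by simp [f, hne]
  have hf_inv {z : ℂ} (hz : z ∈ S) : z = x + f z * (y - x) := by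
    obtain ⟨⟨s, rfl⟩, -⟩ := hz
    rw [hf_param]
  have hCS : connectedComponentIn S w ⊆ S := connectedComponentIn_subset S w
  have hsub : f '' connectedComponentIn S w ⊆ Set.Ioo 0 1 := by
    refine (isPreconnected_connectedComponentIn.image f hf.continuousOn).subset_Ioo_of_endpoints_notMem
      ⟨w, mem_connectedComponentIn hwS, by rw [hwt, hf_param]⟩ ht.1 ht.2 ?_ ?_
    · rintro ⟨z, hz, hfz⟩
      have hzx : z = x := by simpa [hfz] using hf_inv (hCS hz)
      exact (hCS hz).2 (hzx ▸ hx)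
    · rintro ⟨z, hz, hfz⟩
      have hzy : z = y := by simpa [hfz] using hf_inv (hCS hz)
      exact (hCS hz).2 (hzy ▸ hy)
  have hcompact : IsCompact ((fun s : ℝ => x + s * (y - x)) '' Set.Icc 0 1) :=
    isCompact_Icc.image (by fun_prop)
  refine hcompact.isBounded.subset fun z hz => ?_
  exact ⟨f z, Set.Ioo_subset_Icc_self (hsub ⟨z, hz, rfl⟩), (hf_inv (hCS hz)).symm⟩
end
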